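/- arXiv:1604.05783 — 2 statements merged into one kernel-verified Lean document; each statement's English description precedes it below -/
import Mathlib

section
/- (Commutator estimate in the transport regime.) Let σ ≥ 1 and t ≥ 0. There is a constant C(σ) such that for all k, ℓ, η ∈ ℝ³ satisfying |(ℓ, ℓt)| ≤ |(k−ℓ, η−tℓ)|: ⟨η⟩⟨k,η⟩^σ − ⟨η−tℓ⟩⟨k−ℓ, η−tℓ⟩^σ ≤ C(σ) ⟨ℓ, ℓt⟩² ( ⟨η−tℓ⟩⟨k−ℓ, η−tℓ⟩^{σ−1} + ⟨k−ℓ, η−tℓ⟩^σ ). -/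
open MeasureTheory Real Complex
open scoped ENNReal

noncomputable section

abbrev E3 : Type := EuclideanSpace ℝ (Fin 3)

/-- the Japanese bracket ⟨x⟩ = (1+|x|²)^{1/2} -/
def jb (x : E3) : ℝ := Real.sqrt (1 + ‖x‖^2)
/-- ⟨a,b⟩ = (1+|a|²+|b|²)^{1/2} -/
def jbp (a b : E3) : ℝ := Real.sqrt (1 + ‖a‖^2 + ‖b‖^2)
/-- ⟨t⟩ for scalars -/
def jbR (t : ℝ) : ℝ := Real.sqrt (1 + t^2)

/-- the Euclidean norm |(a,b)| of a pair of vectors -/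
def pn (a b : E3) : ℝ := Real.sqrt (‖a‖^2 + ‖b‖^2)

/-- The triangle inequality for the Japanese bracket of a pair. -/
theorem jbp_add_le (a b c d : E3) : jbp (a + c) (b + d) ≤ jbp a b + pn c d := by
  unfold jbp pn
  have hac := norm_add_le a c
  have hbd := norm_add_le b d
  set X := √(1 + ‖a‖ ^ 2 + ‖b‖ ^ 2)
  set P := √(‖c‖ ^ 2 + ‖d‖ ^ 2)
  have hX : X ^ 2 = 1 + ‖a‖ ^ 2 + ‖b‖ ^ 2 := Real.sq_sqrt (by positivity)
  have hP : P ^ 2 = ‖c‖ ^ 2 + ‖d‖ ^ 2 := Real.sq_sqrt (by positivity)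
  have hX0 : 0 ≤ X := Real.sqrt_nonneg _
  have hP0 : 0 ≤ P := Real.sqrt_nonneg _
  have cauchy_schwarz : ‖a‖ * ‖c‖ + ‖b‖ * ‖d‖ ≤ X * P := by
    refine abs_le_of_sq_le_sq' ?_ (by positivity) |>.2
    rw [mul_pow, hX, hP]
    nlinarith [sq_nonneg (‖a‖ * ‖d‖ - ‖b‖ * ‖c‖), sq_nonneg ‖c‖, sq_nonneg ‖d‖]
  refine Real.sqrt_le_iff.2 ⟨by positivity, ?_⟩
  have hac2 : ‖a + c‖ ^ 2 ≤ (‖a‖ + ‖c‖) ^ 2 := by gcongr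
  have hbd2 : ‖b + d‖ ^ 2 ≤ (‖b‖ + ‖d‖) ^ 2 := by gcongr
  nlinarith

theorem jb_add_le (b c d : E3) : jb (b + d) ≤ jb b + pn c d := by
  have h := jbp_add_le 0 b 0 d
  have h0 : pn 0 d ≤ pn c d := Real.sqrt_le_sqrt (by simp)
  simp only [jbp, jb, add_zero, norm_zero] at h ⊢
  norm_num at h
  linarith

theorem one_le_jbp (a b : E3) : 1 ≤ jbp a b :=
  Real.one_le_sqrt.2 (by nlinarith [sq_nonneg ‖a‖, sq_nonneg ‖b‖])

theorem pn_le_jbp (a b : E3) : pn a b ≤ jbp a b :=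
  Real.sqrt_le_sqrt (by linarith)

/-- The tangent line bound for the convex function `x ↦ x ^ σ`. -/
theorem rpow_sub_rpow_le {σ x y : ℝ} (hσ : 1 ≤ σ) (hx : 0 < x) (hy : 0 < y) :
    x ^ σ - y ^ σ ≤ σ * x ^ (σ - 1) * (x - y) := by
  have hyx : 0 < y / x := by positivity
  have h := one_add_mul_self_le_rpow_one_add (s := y / x - 1) (by linarith) hσ
  rw [add_sub_cancel, Real.div_rpow hy.le hx.le, le_div_iff₀ (by positivity)] at h
  have hxσ : x ^ σ = x ^ (σ - 1) * x := by
    rw [← Real.rpow_add_one hx.ne', sub_add_cancel]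
  have e : (1 + σ * (y / x - 1)) * x ^ σ = x ^ σ - σ * x ^ (σ - 1) * (x - y) := by
    rw [hxσ]
    field_simp
    ring
  linarith

/-- Commutator estimate in the transport regime. -/
theorem commutator_estimate_transport (σ : ℝ) (hσ : 1 ≤ σ) :
    ∃ C : ℝ, 0 < C ∧ ∀ t : ℝ, 0 ≤ t → ∀ k ℓ η : E3,
      pn ℓ (t • ℓ) ≤ pn (k - ℓ) (η - t • ℓ) →
      jb η * (jbp k η) ^ σ - jb (η - t • ℓ) * (jbp (k - ℓ) (η - t • ℓ)) ^ σ
        ≤ C * (jbp ℓ (t • ℓ))^2 *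
          (jb (η - t • ℓ) * (jbp (k - ℓ) (η - t • ℓ)) ^ (σ - 1)
            + (jbp (k - ℓ) (η - t • ℓ)) ^ σ) := by
  refine ⟨σ * 2 ^ σ, by positivity, fun t _ k ℓ η hle ↦ ?_⟩
  have hX := jbp_add_le (k - ℓ) (η - t • ℓ) ℓ (t • ℓ)
  have hA := jb_add_le (η - t • ℓ) ℓ (t • ℓ)
  rw [sub_add_cancel] at hX hA
  rw [sub_add_cancel] at hX
  have hpY := hle.trans (pn_le_jbp _ _)
  have hpL := pn_le_jbp ℓ (t • ℓ)
  have hL := one_le_jbp ℓ (t • ℓ)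
  have hY := one_le_jbp (k - ℓ) (η - t • ℓ)
  have hX1 := one_le_jbp k η
  have hB : 0 ≤ jb (η - t • ℓ) := Real.sqrt_nonneg _
  have hp : 0 ≤ pn ℓ (t • ℓ) := Real.sqrt_nonneg _
  generalize jb (η - t • ℓ) = B at *
  generalize jbp (k - ℓ) (η - t • ℓ) = Y at *
  generalize jbp ℓ (t • ℓ) = L at *
  generalize pn ℓ (t • ℓ) = p at *
  generalize jbp k η = X at *
  generalize jb η = A at *
  have hpL2 : p ≤ L ^ 2 := by nlinarith
  have hXY : X ≤ 2 * Y := by linarith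
  have hXσ : X ^ σ ≤ 2 ^ σ * Y ^ σ := by
    rw [← Real.mul_rpow (by norm_num) (by linarith)]
    exact Real.rpow_le_rpow (by linarith) hXY (by linarith)
  have hXσ' : X ^ (σ - 1) ≤ 2 ^ σ * Y ^ (σ - 1) := by
    calc X ^ (σ - 1) ≤ (2 * Y) ^ (σ - 1) :=
          Real.rpow_le_rpow (by linarith) hXY (by linarith)
      _ = 2 ^ (σ - 1) * Y ^ (σ - 1) := Real.mul_rpow (by norm_num) (by linarith)
      _ ≤ 2 ^ σ * Y ^ (σ - 1) := by
          gcongr <;> linarith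
  have hdiff := rpow_sub_rpow_le hσ (by linarith : 0 < X) (by linarith : 0 < Y)
  calc A * X ^ σ - B * Y ^ σ = (A - B) * X ^ σ + B * (X ^ σ - Y ^ σ) := by ring
    _ ≤ p * X ^ σ + B * (σ * X ^ (σ - 1) * p) := by
        gcongr
        · linarith
        · refine hdiff.trans ?_
          gcongr
          linarith
    _ ≤ L ^ 2 * (σ * (2 ^ σ * Y ^ σ)) + B * (σ * (2 ^ σ * Y ^ (σ - 1)) * L ^ 2) := by
        gcongr
        exact hXσ.trans (le_mul_of_one_le_left (by positivity) hσ)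
    _ = σ * 2 ^ σ * L ^ 2 * (B * Y ^ (σ - 1) + Y ^ σ) := by ring
end
end

section
/- (Decaying weighted frequency integral with a singular factor.) Let a > 5 and 0 < δ < 1/2. There is a constant C(a,δ) such that for all t ≥ 0 and all k ∈ ℝ³: ∫_{ℝ³} |ℓ|² ⟨ℓ⟩^{−4} ⟨ℓ, ℓt⟩^{−a} |k−ℓ|^{−2δ} dℓ ≤ C(a,δ) ⟨t⟩^{−(5−2δ)}. -/
open MeasureTheory Real Complex
open scoped ENNReal

noncomputable section

/-- Scaling a nonnegative integral on `E3` by a positive factor. -/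
theorem lintegral_comp_smul_E3 {f : E3 → ℝ≥0∞} (hf : Measurable f) {T : ℝ} (hT : 0 < T) :
    ∫⁻ x : E3, f (T • x) = ENNReal.ofReal (T ^ (-3 : ℝ)) * ∫⁻ x : E3, f x := by
  have h := Measure.map_addHaar_smul (volume : Measure E3) hT.ne'
  rw [← lintegral_map hf (measurable_const_smul T), h, lintegral_smul_measure, smul_eq_mul]
  congr 2
  rw [finrank_euclideanSpace_fin, abs_of_pos (by positivity), Real.rpow_neg hT.le]
  norm_cast

theorem lintegral_jb_rpow_lt_top {r : ℝ} (hr : 3 < r) :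
    ∫⁻ x : E3, ENNReal.ofReal (jb x ^ (-r)) < ∞ := by
  have h : Integrable (fun x : E3 ↦ ((1 : ℝ) + ‖x‖ ^ 2) ^ (-r / 2)) :=
    integrable_rpow_neg_one_add_norm_sq (by simpa [finrank_euclideanSpace_fin] using hr)
  convert h.lintegral_lt_top using 4 with x
  rw [jb, Real.sqrt_eq_rpow, ← Real.rpow_mul (by positivity)]
  ring_nf

theorem lintegral_ball_norm_rpow_lt_top {s : ℝ} (hs : s < 3) :
    ∫⁻ x in Metric.ball (0 : E3) 1, ENNReal.ofReal (‖x‖ ^ (-s)) < ∞ := by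
  have h : IntegrableOn (fun x : E3 ↦ ‖x‖ ^ (-s)) (Metric.ball 0 1) := by
    refine integrableOn_ball_of_norm_le_rpow (C := 1) (α := s) ?_ ?_ ?_ ?_
    · simp
    · simpa using hs
    · refine Filter.Eventually.of_forall fun x ↦ ?_
      rw [Real.norm_of_nonneg (by positivity), one_mul]
    · exact Measurable.aestronglyMeasurable (by fun_prop)
  exact h.lintegral_lt_top

theorem one_le_jb (x : E3) : 1 ≤ jb x :=
  Real.one_le_sqrt.2 (le_add_of_nonneg_right (sq_nonneg _))

theorem norm_le_jb (x : E3) : ‖x‖ ≤ jb x :=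
  Real.le_sqrt_of_sq_le (by linarith)

theorem measurable_jb : Measurable jb := by
  unfold jb
  fun_prop

/-- A singular weight centred anywhere is integrable against a decaying bracket, uniformly in the
centre. -/
theorem lintegral_jb_rpow_mul_norm_sub_rpow_le {r s : ℝ} (hr : 0 ≤ r) (hs : 0 ≤ s) (k : E3) :
    ∫⁻ x : E3, ENNReal.ofReal (jb x ^ (-r) * ‖k - x‖ ^ (-s)) ≤
      (∫⁻ x : E3, ENNReal.ofReal (jb x ^ (-r))) +
        ∫⁻ x in Metric.ball (0 : E3) 1, ENNReal.ofReal (‖x‖ ^ (-s)) := by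
  set g : E3 → ℝ≥0∞ := (Metric.ball 0 1).indicator fun x ↦ ENNReal.ofReal (‖x‖ ^ (-s))
  have hg : ∫⁻ x in Metric.ball (0 : E3) 1, ENNReal.ofReal (‖x‖ ^ (-s)) = ∫⁻ x, g (k - x) := by
    rw [lintegral_sub_left_eq_self g k, lintegral_indicator measurableSet_ball]
  have hm : Measurable fun x : E3 ↦ ENNReal.ofReal (jb x ^ (-r)) :=
    (measurable_jb.pow_const _).ennreal_ofReal
  rw [hg, ← lintegral_add_left hm]
  refine lintegral_mono fun x ↦ ?_
  have hj : 0 ≤ jb x := zero_le_one.trans (one_le_jb x)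
  by_cases hx : ‖k - x‖ < 1
  · refine le_add_left ?_
    rw [show g (k - x) = ENNReal.ofReal (‖k - x‖ ^ (-s)) from
      Set.indicator_of_mem (mem_ball_zero_iff.2 hx) _]
    exact ENNReal.ofReal_le_ofReal (mul_le_of_le_one_left (by positivity)
      (Real.rpow_le_one_of_one_le_of_nonpos (one_le_jb x) (by linarith)))
  · refine le_add_right (ENNReal.ofReal_le_ofReal (mul_le_of_le_one_right (by positivity) ?_))
    exact Real.rpow_le_one_of_one_le_of_nonpos (not_lt.1 hx) (by linarith)

theorem jbp_smul_eq_jb (t : ℝ) (x : E3) : jbp x (t • x) = jb (jbR t • x) := by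
  rw [jbp, jb, jbR, norm_smul, norm_smul, mul_pow, mul_pow, Real.norm_eq_abs, Real.norm_eq_abs,
    sq_abs, sq_abs, Real.sq_sqrt (by positivity)]
  ring_nf

/-- Pointwise comparison of the integrand with a rescaled profile. -/
theorem integrand_le_rescaled {a s : ℝ} (t : ℝ) (k x : E3) :
    ‖x‖ ^ 2 * jb x ^ (-4 : ℝ) * jbp x (t • x) ^ (-a) * ‖k - x‖ ^ (-s) ≤
      jbR t ^ (s - 2) *
        (jb (jbR t • x) ^ (-(a - 2)) * ‖jbR t • k - jbR t • x‖ ^ (-s)) := by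
  have hT : 0 < jbR t := Real.sqrt_pos.2 (by positivity)
  have hj : 0 < jb (jbR t • x) := zero_lt_one.trans_le (one_le_jb _)
  have h4 : jb x ^ (-4 : ℝ) ≤ 1 :=
    Real.rpow_le_one_of_one_le_of_nonpos (one_le_jb x) (by norm_num)
  have hx : ‖x‖ ^ 2 ≤ jbR t ^ (-2 : ℝ) * jb (jbR t • x) ^ 2 := by
    have h := pow_le_pow_left₀ (norm_nonneg _) (norm_le_jb (jbR t • x)) 2
    rw [norm_smul, Real.norm_of_nonneg hT.le, mul_pow] at h
    rw [Real.rpow_neg hT.le, Real.rpow_ofNat, ← div_eq_inv_mul, le_div_iff₀ (by positivity)]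
    linarith
  have hn : jbR t ^ s * ‖jbR t • k - jbR t • x‖ ^ (-s) = ‖k - x‖ ^ (-s) := by
    rw [← smul_sub, norm_smul, Real.norm_of_nonneg hT.le,
      Real.mul_rpow hT.le (norm_nonneg _), ← mul_assoc, ← Real.rpow_add hT]
    simp
  have ha : jb (jbR t • x) ^ (-(a - 2)) = jb (jbR t • x) ^ 2 * jb (jbR t • x) ^ (-a) := by
    rw [← Real.rpow_ofNat, ← Real.rpow_add hj]
    ring_nf
  rw [jbp_smul_eq_jb, sub_eq_add_neg s, Real.rpow_add hT, ha, ← hn]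
  calc _ ≤ (jbR t ^ (-2 : ℝ) * jb (jbR t • x) ^ 2) * 1 * jb (jbR t • x) ^ (-a) *
        (jbR t ^ s * ‖jbR t • k - jbR t • x‖ ^ (-s)) := by
        have := zero_lt_one.trans_le (one_le_jb x)
        gcongr
    _ = _ := by ring

/-- Decaying weighted frequency integral with a singular factor. -/
theorem weighted_frequency_integral_decay (a δ : ℝ) (ha : 5 < a)
    (hδ0 : 0 < δ) (hδ : δ < 1/2) :
    ∃ C : ℝ, 0 < C ∧ ∀ t : ℝ, 0 ≤ t → ∀ k : E3,
      (∫⁻ ℓ : E3,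
        ENNReal.ofReal (‖ℓ‖^2 * (jb ℓ) ^ (-4 : ℝ) * (jbp ℓ (t • ℓ)) ^ (-a) *
          ‖k - ℓ‖ ^ (-(2*δ))))
        ≤ ENNReal.ofReal (C * (jbR t) ^ (-(5 - 2*δ))) := by
  set I : ℝ≥0∞ := (∫⁻ x : E3, ENNReal.ofReal (jb x ^ (-(a - 2)))) +
    ∫⁻ x in Metric.ball (0 : E3) 1, ENNReal.ofReal (‖x‖ ^ (-(2 * δ)))
  have hI : I ≠ ∞ := (ENNReal.add_lt_top.2 ⟨lintegral_jb_rpow_lt_top (by linarith),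
    lintegral_ball_norm_rpow_lt_top (by linarith)⟩).ne
  refine ⟨I.toReal + 1, by positivity, fun t _ k ↦ ?_⟩
  have hT : 0 < jbR t := Real.sqrt_pos.2 (by positivity)
  set f : E3 → ℝ≥0∞ := fun x ↦
    ENNReal.ofReal (jb x ^ (-(a - 2)) * ‖jbR t • k - x‖ ^ (-(2 * δ)))
  have hf : Measurable f := by
    have := measurable_jb
    fun_prop
  calc _ ≤ ∫⁻ x : E3, ENNReal.ofReal (jbR t ^ (2 * δ - 2)) * f (jbR t • x) := by
        refine lintegral_mono fun x ↦ ?_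
        rw [← ENNReal.ofReal_mul (by positivity)]
        exact ENNReal.ofReal_le_ofReal (integrand_le_rescaled t k x)
    _ = ENNReal.ofReal (jbR t ^ (2 * δ - 2)) *
          (ENNReal.ofReal (jbR t ^ (-3 : ℝ)) * ∫⁻ x, f x) := by
        rw [lintegral_const_mul _ (by fun_prop), lintegral_comp_smul_E3 hf hT]
    _ ≤ ENNReal.ofReal (jbR t ^ (2 * δ - 2)) *
          (ENNReal.ofReal (jbR t ^ (-3 : ℝ)) * ENNReal.ofReal (I.toReal + 1)) := by
        gcongr
        refine (lintegral_jb_rpow_mul_norm_sub_rpow_le (by linarith) (by linarith) _).trans ?_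
        exact (ENNReal.ofReal_toReal hI).symm.le.trans (ENNReal.ofReal_le_ofReal (by linarith))
    _ = _ := by
        rw [← ENNReal.ofReal_mul (by positivity), ← ENNReal.ofReal_mul (by positivity),
          ← mul_assoc, ← Real.rpow_add hT, mul_comm]
        ring_nf
end
end
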